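/- arXiv:2011.07969 — 8 statements merged into one kernel-verified Lean document; each statement's English description precedes it below -/
import Mathlib

section
/- Let γ > 0 and assume the solution set Ω of the split equality problem is nonempty. Then a pair (x, y) ∈ H₁ × H₂ is a solution of the split equality problem (i.e., x ∈ C, y ∈ Q and Ax = By) if and only if it solves the fixed-point equations x = x − γ[(I − P_C)x + A*(Ax − By)] and y = y − γ[(I − P_Q)y − B*(Ax − By)], equivalently (I − P_C)x + A*(Ax − By) = 0 and (I − P_Q)y − B*(Ax − By) = 0. -/
open RealInnerProductSpace

/-- If `p` satisfies the variational inequality of the projection of `x`, tested at `z`, then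
`‖x - p‖ ^ 2` is a lower bound for the inner product of `x - p` with `x - z`. -/
theorem norm_sub_sq_le_inner_of_inner_nonpos {H : Type*} [NormedAddCommGroup H]
    [InnerProductSpace ℝ H] {x p z : H} (h : ⟪x - p, z - p⟫ ≤ 0) :
    ‖x - p‖ ^ 2 ≤ ⟪x - p, x - z⟫ := by
  have hsplit : x - z = (x - p) - (z - p) := by abel
  rw [hsplit, inner_sub_right, real_inner_self_eq_norm_sq]
  linarith

/-- If the variational inequality for the projection `p` of `x` holds at `x` itself, then `x = p`. -/
theorem eq_of_inner_sub_self_nonpos {H : Type*} [NormedAddCommGroup H]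
    [InnerProductSpace ℝ H] {x p : H} (h : ⟪x - p, x - p⟫ ≤ 0) : x = p :=
  sub_eq_zero.mp (real_inner_self_nonpos.mp h)

theorem eq_sub_smul_iff_eq_zero {H : Type*} [AddCommGroup H] [Module ℝ H] {γ : ℝ} (hγ : γ ≠ 0)
    {x v : H} : x = x - γ • v ↔ v = 0 := by
  rw [eq_comm, sub_eq_self, smul_eq_zero_iff_right hγ]

/-- Lemma 2.1: for γ > 0, (x, y) solves the split equality problem iff it solves the
fixed-point equations. -/
theorem split_equality_fixed_point_characterization
    {H₁ H₂ H₃ : Type*}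
    [NormedAddCommGroup H₁] [InnerProductSpace ℝ H₁] [CompleteSpace H₁]
    [NormedAddCommGroup H₂] [InnerProductSpace ℝ H₂] [CompleteSpace H₂]
    [NormedAddCommGroup H₃] [InnerProductSpace ℝ H₃] [CompleteSpace H₃]
    (C : Set H₁) (Q : Set H₂)
    (hCne : C.Nonempty) (hCclosed : IsClosed C) (hCconv : Convex ℝ C)
    (hQne : Q.Nonempty) (hQclosed : IsClosed Q) (hQconv : Convex ℝ Q)
    (A : H₁ →L[ℝ] H₃) (B : H₂ →L[ℝ] H₃)
    (PC : H₁ → H₁) (hPC_mem : ∀ x, PC x ∈ C)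
    (hPC : ∀ x, ∀ z ∈ C, ⟪x - PC x, z - PC x⟫ ≤ 0)
    (PQ : H₂ → H₂) (hPQ_mem : ∀ y, PQ y ∈ Q)
    (hPQ : ∀ y, ∀ z ∈ Q, ⟪y - PQ y, z - PQ y⟫ ≤ 0)
    (hΩne : ∃ p : H₁ × H₂, p.1 ∈ C ∧ p.2 ∈ Q ∧ A p.1 = B p.2)
    (γ : ℝ) (hγ : 0 < γ) (x : H₁) (y : H₂) :
    (x ∈ C ∧ y ∈ Q ∧ A x = B y) ↔
      (x = x - γ • ((x - PC x) + (ContinuousLinearMap.adjoint A) (A x - B y)) ∧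
       y = y - γ • ((y - PQ y) - (ContinuousLinearMap.adjoint B) (A x - B y))) := by
  rw [eq_sub_smul_iff_eq_zero hγ.ne', eq_sub_smul_iff_eq_zero hγ.ne']
  constructor
  · rintro ⟨hx, hy, hxy⟩
    have hPx := eq_of_inner_sub_self_nonpos (hPC x x hx)
    have hPy := eq_of_inner_sub_self_nonpos (hPQ y y hy)
    simp [← hPx, ← hPy, hxy]
  · rintro ⟨h₁, h₂⟩
    obtain ⟨⟨p, q⟩, hp, hq, hpq⟩ := hΩne
    dsimp only at hp hq hpq
    have hC := norm_sub_sq_le_inner_of_inner_nonpos (hPC x p hp)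
    have hQ := norm_sub_sq_le_inner_of_inner_nonpos (hPQ y q hq)
    have hA : ⟪x - PC x, x - p⟫ = -⟪A x - B y, A x - A p⟫ := by
      rw [eq_neg_of_add_eq_zero_left h₁, inner_neg_left,
        ContinuousLinearMap.adjoint_inner_left, map_sub]
    have hB : ⟪y - PQ y, y - q⟫ = ⟪A x - B y, B y - B q⟫ := by
      rw [sub_eq_zero.mp h₂, ContinuousLinearMap.adjoint_inner_left, map_sub]
    have hsum : ⟪A x - B y, A x - A p⟫ - ⟪A x - B y, B y - B q⟫ = ‖A x - B y‖ ^ 2 := by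
      rw [← inner_sub_right, hpq, sub_sub_sub_cancel_right, real_inner_self_eq_norm_sq]
    have hx : ‖x - PC x‖ ^ 2 = 0 := by
      linarith [sq_nonneg ‖x - PC x‖, sq_nonneg ‖y - PQ y‖, sq_nonneg ‖A x - B y‖]
    have hy : ‖y - PQ y‖ ^ 2 = 0 := by
      linarith [sq_nonneg ‖x - PC x‖, sq_nonneg ‖y - PQ y‖, sq_nonneg ‖A x - B y‖]
    have hr : ‖A x - B y‖ ^ 2 = 0 := by
      linarith [sq_nonneg ‖x - PC x‖, sq_nonneg ‖y - PQ y‖, sq_nonneg ‖A x - B y‖]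
    rw [sq_eq_zero_iff, norm_eq_zero, sub_eq_zero] at hx hy hr
    exact ⟨hx ▸ hPC_mem x, hy ▸ hPQ_mem y, hr⟩
end

section
/- Let x* ∈ C and y* ∈ Q. For any x ∈ H₁, y ∈ H₂ and any γ ≥ 0, set x̂ = x − γ[(I − P_C)x + A*(Ax − By)]. Then ‖x̂ − x*‖² ≤ ‖x − x*‖² − 2γ‖(I − P_C)x‖² − 2γ⟨Ax − By, Ax − Ax*⟩ + 2γ²(‖(I − P_C)x‖² + ‖A*(Ax − By)‖²). -/
open RealInnerProductSpace

/-- The basic one-step estimate (inequality (3.2) in the paper): for xhat = x − γ[(I − P_C)x +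
A*(Ax − By)] one has
‖xhat − x*‖² ≤ ‖x − x*‖² − 2γ‖(I − P_C)x‖² − 2γ⟨Ax − By, Ax − Ax*⟩
            + 2γ²(‖(I − P_C)x‖² + ‖A*(Ax − By)‖²). -/
theorem one_step_estimate
    {H₁ H₂ H₃ : Type*}
    [NormedAddCommGroup H₁] [InnerProductSpace ℝ H₁] [CompleteSpace H₁]
    [NormedAddCommGroup H₂] [InnerProductSpace ℝ H₂] [CompleteSpace H₂]
    [NormedAddCommGroup H₃] [InnerProductSpace ℝ H₃] [CompleteSpace H₃]
    (C : Set H₁) (Q : Set H₂)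
    (hCne : C.Nonempty) (hCclosed : IsClosed C) (hCconv : Convex ℝ C)
    (hQne : Q.Nonempty) (hQclosed : IsClosed Q) (hQconv : Convex ℝ Q)
    (A : H₁ →L[ℝ] H₃) (B : H₂ →L[ℝ] H₃)
    (PC : H₁ → H₁) (hPC_mem : ∀ x, PC x ∈ C)
    (hPC : ∀ x, ∀ z ∈ C, ⟪x - PC x, z - PC x⟫ ≤ 0)
    (xs : H₁) (ys : H₂) (hxs : xs ∈ C) (hys : ys ∈ Q)
    (x : H₁) (y : H₂) (γ : ℝ) (hγ : 0 ≤ γ) (xhat : H₁)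
    (hxhat : xhat = x - γ • ((x - PC x) + (ContinuousLinearMap.adjoint A) (A x - B y))) :
    ‖xhat - xs‖ ^ 2 ≤ ‖x - xs‖ ^ 2 - 2 * γ * ‖x - PC x‖ ^ 2
      - 2 * γ * ⟪A x - B y, A x - A xs⟫
      + 2 * γ ^ 2 * (‖x - PC x‖ ^ 2
        + ‖(ContinuousLinearMap.adjoint A) (A x - B y)‖ ^ 2) := by
  have hproj : ‖x - PC x‖ ^ 2 ≤ ⟪x - xs, x - PC x⟫ := by
    have h := hPC x xs hxs
    have hsplit : xs - PC x = (x - PC x) - (x - xs) := by abel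
    rw [hsplit, inner_sub_right, real_inner_self_eq_norm_sq, real_inner_comm] at h
    linarith
  have hadj : ⟪x - xs, (ContinuousLinearMap.adjoint A) (A x - B y)⟫
      = ⟪A x - B y, A x - A xs⟫ := by
    rw [ContinuousLinearMap.adjoint_inner_right, map_sub, real_inner_comm]
  have hstep : xhat - xs
      = (x - xs) - γ • ((x - PC x) + (ContinuousLinearMap.adjoint A) (A x - B y)) := by
    rw [hxhat]
    abel
  rw [hstep, ← hadj]
  generalize (ContinuousLinearMap.adjoint A) (A x - B y) = w
  have hpar := parallelogram_law_with_norm ℝ (x - PC x) w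
  have hsum : ‖(x - PC x) + w‖ ^ 2 ≤ 2 * (‖x - PC x‖ ^ 2 + ‖w‖ ^ 2) := by
    nlinarith [sq_nonneg ‖(x - PC x) - w‖]
  rw [norm_sub_sq_real, inner_smul_right, inner_add_right, norm_smul, mul_pow,
    Real.norm_eq_abs, sq_abs]
  linarith [mul_le_mul_of_nonneg_left hproj hγ, mul_le_mul_of_nonneg_left hsum (sq_nonneg γ)]
end

section
/- Let x* ∈ C, y* ∈ Q with Ax* = By*. For any x ∈ H₁, y ∈ H₂ and any γ ≥ 0, set x̂ = x − γ[(I − P_C)x + A*(Ax − By)] and ŷ = y − γ[(I − P_Q)y − B*(Ax − By)]. Then ‖x̂ − x*‖² + ‖ŷ − y*‖² ≤ ‖x − x*‖² + ‖y − y*‖² − 2γ(1 − γ)(‖(I − P_C)x‖² + ‖(I − P_Q)y‖²) − 2γ(‖Ax − By‖² − γ‖A*(Ax − By)‖² − γ‖B*(Ax − By)‖²). In particular, if 0 < γ < 1 and γ(‖A*(Ax − By)‖² + ‖B*(Ax − By)‖²) ≤ ‖Ax − By‖², then ‖x̂ − x*‖² + ‖ŷ − y*‖² ≤ ‖x − x*‖²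 + ‖y − y*‖². -/
open RealInnerProductSpace

/-- One-step estimate for a step along `-(x - p + g)`, where `p` satisfies the variational
inequality of the projection of `x` tested at the point `z`. -/
theorem norm_sub_smul_add_sub_sq_le {E : Type*} [NormedAddCommGroup E] [InnerProductSpace ℝ E]
    {x p z : E} (h : ⟪x - p, z - p⟫ ≤ 0) {γ : ℝ} (hγ : 0 ≤ γ) (g : E) :
    ‖x - γ • (x - p + g) - z‖ ^ 2 ≤ ‖x - z‖ ^ 2 - 2 * γ * (1 - γ) * ‖x - p‖ ^ 2
      - 2 * γ * ⟪g, x - z⟫ + 2 * γ ^ 2 * ‖g‖ ^ 2 := by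
  have hmono : ‖x - p‖ ^ 2 ≤ ⟪x - p, x - z⟫ := by
    rw [← sub_sub_sub_cancel_right x z p, inner_sub_right, real_inner_self_eq_norm_sq]
    linarith
  have hsum : ‖x - p + g‖ ^ 2 ≤ 2 * (‖x - p‖ ^ 2 + ‖g‖ ^ 2) := by
    linarith [parallelogram_law_with_norm ℝ (x - p) g, mul_self_nonneg ‖x - p - g‖]
  have hexp : ‖x - γ • (x - p + g) - z‖ ^ 2 = ‖x - z‖ ^ 2
      - 2 * γ * (⟪x - p, x - z⟫ + ⟪g, x - z⟫) + γ ^ 2 * ‖x - p + g‖ ^ 2 := by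
    rw [sub_right_comm, norm_sub_sq_real, inner_smul_right, real_inner_comm, inner_add_left,
      norm_smul, mul_pow, Real.norm_eq_abs, sq_abs]
    ring
  rw [hexp]
  linarith [mul_le_mul_of_nonneg_left hmono hγ, mul_le_mul_of_nonneg_left hsum (sq_nonneg γ)]

/-- The combined one-step estimate (inequality (3.4) in the paper), together with the
"in particular" Fejér-type monotonicity under the stepsize condition. -/
theorem two_step_estimate
    {H₁ H₂ H₃ : Type*}
    [NormedAddCommGroup H₁] [InnerProductSpace ℝ H₁] [CompleteSpace H₁]
    [NormedAddCommGroup H₂] [InnerProductSpace ℝ H₂] [CompleteSpace H₂]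
    [NormedAddCommGroup H₃] [InnerProductSpace ℝ H₃] [CompleteSpace H₃]
    (C : Set H₁) (Q : Set H₂)
    (hCne : C.Nonempty) (hCclosed : IsClosed C) (hCconv : Convex ℝ C)
    (hQne : Q.Nonempty) (hQclosed : IsClosed Q) (hQconv : Convex ℝ Q)
    (A : H₁ →L[ℝ] H₃) (B : H₂ →L[ℝ] H₃)
    (PC : H₁ → H₁) (hPC_mem : ∀ x, PC x ∈ C)
    (hPC : ∀ x, ∀ z ∈ C, ⟪x - PC x, z - PC x⟫ ≤ 0)
    (PQ : H₂ → H₂) (hPQ_mem : ∀ y, PQ y ∈ Q)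
    (hPQ : ∀ y, ∀ z ∈ Q, ⟪y - PQ y, z - PQ y⟫ ≤ 0)
    (xs : H₁) (ys : H₂) (hxs : xs ∈ C) (hys : ys ∈ Q) (hAB : A xs = B ys)
    (x : H₁) (y : H₂) (γ : ℝ) (hγ : 0 ≤ γ) (xhat : H₁) (yhat : H₂)
    (hxhat : xhat = x - γ • ((x - PC x) + (ContinuousLinearMap.adjoint A) (A x - B y)))
    (hyhat : yhat = y - γ • ((y - PQ y) - (ContinuousLinearMap.adjoint B) (A x - B y))) :
    (‖xhat - xs‖ ^ 2 + ‖yhat - ys‖ ^ 2 ≤ ‖x - xs‖ ^ 2 + ‖y - ys‖ ^ 2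
      - 2 * γ * (1 - γ) * (‖x - PC x‖ ^ 2 + ‖y - PQ y‖ ^ 2)
      - 2 * γ * (‖A x - B y‖ ^ 2
        - γ * ‖(ContinuousLinearMap.adjoint A) (A x - B y)‖ ^ 2
        - γ * ‖(ContinuousLinearMap.adjoint B) (A x - B y)‖ ^ 2)) ∧
    (0 < γ → γ < 1 →
      γ * (‖(ContinuousLinearMap.adjoint A) (A x - B y)‖ ^ 2
        + ‖(ContinuousLinearMap.adjoint B) (A x - B y)‖ ^ 2) ≤ ‖A x - B y‖ ^ 2 →
      ‖xhat - xs‖ ^ 2 + ‖yhat - ys‖ ^ 2 ≤ ‖x - xs‖ ^ 2 + ‖y - ys‖ ^ 2) := by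
  have hx := norm_sub_smul_add_sub_sq_le (hPC x xs hxs) hγ (ContinuousLinearMap.adjoint A (A x - B y))
  have hy := norm_sub_smul_add_sub_sq_le (hPQ y ys hys) hγ (-ContinuousLinearMap.adjoint B (A x - B y))
  rw [← hxhat] at hx
  rw [← sub_eq_add_neg, ← hyhat, norm_neg, inner_neg_left] at hy
  have hr : ⟪ContinuousLinearMap.adjoint A (A x - B y), x - xs⟫
      - ⟪ContinuousLinearMap.adjoint B (A x - B y), y - ys⟫ = ‖A x - B y‖ ^ 2 := by
    rw [ContinuousLinearMap.adjoint_inner_left, ContinuousLinearMap.adjoint_inner_left,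
      ← inner_sub_right, map_sub, map_sub, hAB, sub_sub_sub_cancel_right,
      real_inner_self_eq_norm_sq]
  have key : ‖xhat - xs‖ ^ 2 + ‖yhat - ys‖ ^ 2 ≤ ‖x - xs‖ ^ 2 + ‖y - ys‖ ^ 2
      - 2 * γ * (1 - γ) * (‖x - PC x‖ ^ 2 + ‖y - PQ y‖ ^ 2)
      - 2 * γ * (‖A x - B y‖ ^ 2
        - γ * ‖(ContinuousLinearMap.adjoint A) (A x - B y)‖ ^ 2
        - γ * ‖(ContinuousLinearMap.adjoint B) (A x - B y)‖ ^ 2) := by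
    rw [← hr]
    linarith
  refine ⟨key, fun _ hγ1 hstep => ?_⟩
  have hproj : 0 ≤ 2 * γ * (1 - γ) * (‖x - PC x‖ ^ 2 + ‖y - PQ y‖ ^ 2) := by
    have := sub_nonneg.2 hγ1.le
    positivity
  have hres := mul_nonneg (mul_nonneg zero_le_two hγ) (sub_nonneg.2 hstep)
  linarith
end

section
/- Assume Ω ≠ ∅ and let (x*, y*) ∈ Ω. Let {u_n} ⊆ H₁ and {v_n} ⊆ H₂ be convergent sequences, {δ_n} ⊆ (0,1), and let {γ_n} be the self-adaptive stepsizes. Let {(x_n, y_n)} be generated from arbitrary (x₀, y₀) by x̂_n = x_n − γ_n[(I − P_C)x_n + A*(Ax_n − By_n)], x_{n+1} = δ_n u_n + (1 − δ_n)x̂_n, ŷ_n = y_n − γ_n[(I − P_Q)y_n − B*(Ax_n − By_n)], y_{n+1} = δ_n v_n + (1 − δ_n)ŷ_n. If G ≥ 0 satisfies sup_{n≥0} max{‖u_n − x*‖², ‖v_n − y*‖²} ≤ G/2, then for all n ≥ 0, ‖x_n − x*‖² + ‖y_n − y*‖² ≤ max{G, ‖x₀ − x*‖² + ‖y₀ −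 y*‖²}; in particular the sequences {x_n} and {y_n} are bounded. -/
open RealInnerProductSpace Filter Topology Classical

/-- Convexity of the squared distance to a point `s`. -/
lemma norm_sq_convex_combination_sub_le {E : Type*} [NormedAddCommGroup E] [InnerProductSpace ℝ E]
    (a b s : E) {t : ℝ} (h0 : 0 ≤ t) (h1 : t ≤ 1) :
    ‖t • a + (1 - t) • b - s‖ ^ 2 ≤ t * ‖a - s‖ ^ 2 + (1 - t) * ‖b - s‖ ^ 2 := by
  have h : t • a + (1 - t) • b - s = t • (a - s) + (1 - t) • (b - s) := by module
  have hab := norm_sub_sq_real (a - s) (b - s)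
  rw [h, norm_add_sq_real, norm_smul, norm_smul, mul_pow, mul_pow, Real.norm_eq_abs,
    Real.norm_eq_abs, sq_abs, sq_abs, real_inner_smul_left, real_inner_smul_right]
  nlinarith [mul_nonneg (mul_nonneg h0 (sub_nonneg.2 h1)) (sq_nonneg ‖(a - s) - (b - s)‖)]

/-- The residual `x - p` of a point `p` satisfying the projection inequality at `z` has
inner product at least `‖x - p‖ ^ 2` with `x - z`. -/
lemma norm_sq_le_inner_of_inner_le_zero {E : Type*} [NormedAddCommGroup E] [InnerProductSpace ℝ E]
    {x p z : E} (h : ⟪x - p, z - p⟫ ≤ 0) : ‖x - p‖ ^ 2 ≤ ⟪x - p, x - z⟫ := by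
  have e : x - z = (x - p) - (z - p) := by abel
  rw [e, inner_sub_right, real_inner_self_eq_norm_sq]
  linarith

lemma norm_sub_smul_add_sq_le {E : Type*} [NormedAddCommGroup E] [InnerProductSpace ℝ E]
    (d p a : E) (c : ℝ) :
    ‖d - c • (p + a)‖ ^ 2 ≤
      ‖d‖ ^ 2 - 2 * c * (⟪p, d⟫ + ⟪a, d⟫) + c ^ 2 * (2 * ‖p‖ ^ 2 + 2 * ‖a‖ ^ 2) := by
  rw [norm_sub_sq_real, norm_smul, mul_pow, Real.norm_eq_abs, sq_abs, real_inner_smul_right,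
    inner_add_right, real_inner_comm p d, real_inner_comm a d]
  have h := parallelogram_law_with_norm ℝ p a
  nlinarith [mul_nonneg (sq_nonneg c) (sq_nonneg ‖p - a‖)]

lemma self_adaptive_stepsize_bounds {a N S : ℝ} (ha0 : 0 ≤ a) (ha1 : a ≤ 1) (hN : 0 ≤ N)
    (hS : 0 ≤ S) :
    0 ≤ a * min 1 (N / S) ∧ a * min 1 (N / S) ≤ 1 ∧ a * min 1 (N / S) * S ≤ N := by
  have hm0 : 0 ≤ min 1 (N / S) := le_min zero_le_one (div_nonneg hN hS)
  have hmS : min 1 (N / S) * S ≤ N := by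
    rcases hS.eq_or_lt with rfl | hS'
    · simpa using hN
    · exact (mul_le_mul_of_nonneg_right (min_le_right _ _) hS).trans_eq
        (div_mul_cancel₀ N hS'.ne')
  refine ⟨mul_nonneg ha0 hm0, mul_le_one₀ ha1 hm0 (min_le_left _ _), ?_⟩
  nlinarith [mul_nonneg hm0 hS]

/-- One step of the simultaneous projection iteration does not increase the distance to a solution
of the split equality problem. -/
lemma split_equality_step_norm_sq_le {H₁ H₂ H₃ : Type*}
    [NormedAddCommGroup H₁] [InnerProductSpace ℝ H₁] [CompleteSpace H₁]
    [NormedAddCommGroup H₂] [InnerProductSpace ℝ H₂] [CompleteSpace H₂]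
    [NormedAddCommGroup H₃] [InnerProductSpace ℝ H₃] [CompleteSpace H₃]
    (A : H₁ →L[ℝ] H₃) (B : H₂ →L[ℝ] H₃) {x p xs : H₁} {y q ys : H₂} {c : ℝ}
    (hp : ⟪x - p, xs - p⟫ ≤ 0) (hq : ⟪y - q, ys - q⟫ ≤ 0) (hAB : A xs = B ys)
    (h0 : 0 ≤ c) (h1 : c ≤ 1)
    (hc : c * (‖(ContinuousLinearMap.adjoint A) (A x - B y)‖ ^ 2 +
      ‖(ContinuousLinearMap.adjoint B) (A x - B y)‖ ^ 2) ≤ ‖A x - B y‖ ^ 2) :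
    ‖x - c • ((x - p) + (ContinuousLinearMap.adjoint A) (A x - B y)) - xs‖ ^ 2 +
      ‖y - c • ((y - q) - (ContinuousLinearMap.adjoint B) (A x - B y)) - ys‖ ^ 2 ≤
      ‖x - xs‖ ^ 2 + ‖y - ys‖ ^ 2 := by
  have hp' := norm_sq_le_inner_of_inner_le_zero hp
  have hq' := norm_sq_le_inner_of_inner_le_zero hq
  have hx := norm_sub_smul_add_sq_le (x - xs) (x - p) (ContinuousLinearMap.adjoint A (A x - B y)) c
  have hy := norm_sub_smul_add_sq_le (y - ys) (y - q)
    (-ContinuousLinearMap.adjoint B (A x - B y)) c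
  rw [inner_neg_left, norm_neg, ← sub_eq_add_neg] at hy
  have hw : ⟪ContinuousLinearMap.adjoint A (A x - B y), x - xs⟫ -
      ⟪ContinuousLinearMap.adjoint B (A x - B y), y - ys⟫ = ‖A x - B y‖ ^ 2 := by
    rw [ContinuousLinearMap.adjoint_inner_left, ContinuousLinearMap.adjoint_inner_left,
      ← inner_sub_right, map_sub, map_sub, hAB, sub_sub_sub_cancel_right,
      real_inner_self_eq_norm_sq]
  rw [sub_right_comm x, sub_right_comm y]
  have hcc : 0 ≤ c * (1 - c) := mul_nonneg h0 (sub_nonneg.2 h1)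
  have hcp := mul_nonneg hcc (sq_nonneg ‖x - p‖)
  have hcq := mul_nonneg hcc (sq_nonneg ‖y - q‖)
  have hcp' := mul_le_mul_of_nonneg_left hp' h0
  have hcq' := mul_le_mul_of_nonneg_left hq' h0
  have hcw := congrArg (fun r => c * r) hw
  have hcS := mul_le_mul_of_nonneg_left hc h0
  linarith

/-- Boundedness of the Halpern-type iterates (inequality (3.5) in the paper). -/
theorem halpern_iterates_bounded
    {H₁ H₂ H₃ : Type*}
    [NormedAddCommGroup H₁] [InnerProductSpace ℝ H₁] [CompleteSpace H₁]
    [NormedAddCommGroup H₂] [InnerProductSpace ℝ H₂] [CompleteSpace H₂]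
    [NormedAddCommGroup H₃] [InnerProductSpace ℝ H₃] [CompleteSpace H₃]
    (C : Set H₁) (Q : Set H₂)
    (hCne : C.Nonempty) (hCclosed : IsClosed C) (hCconv : Convex ℝ C)
    (hQne : Q.Nonempty) (hQclosed : IsClosed Q) (hQconv : Convex ℝ Q)
    (A : H₁ →L[ℝ] H₃) (B : H₂ →L[ℝ] H₃)
    (PC : H₁ → H₁) (hPC_mem : ∀ x, PC x ∈ C)
    (hPC : ∀ x, ∀ z ∈ C, ⟪x - PC x, z - PC x⟫ ≤ 0)
    (PQ : H₂ → H₂) (hPQ_mem : ∀ y, PQ y ∈ Q)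
    (hPQ : ∀ y, ∀ z ∈ Q, ⟪y - PQ y, z - PQ y⟫ ≤ 0)
    -- (x*, y*) ∈ Ω
    (xs : H₁) (ys : H₂) (hxs : xs ∈ C) (hys : ys ∈ Q) (hAB : A xs = B ys)
    -- parameters
    (u : ℕ → H₁) (v : ℕ → H₂)
    (hu : ∃ ulim, Tendsto u atTop (nhds ulim))
    (hv : ∃ vlim, Tendsto v atTop (nhds vlim))
    (δ α γ : ℕ → ℝ)
    (hδ : ∀ n, δ n ∈ Set.Ioo (0 : ℝ) 1)
    (hα : ∀ n, α n ∈ Set.Ioo (0 : ℝ) 1)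
    -- iterates
    (x xhat : ℕ → H₁) (y yhat : ℕ → H₂)
    -- self-adaptive stepsize
    (hγ : ∀ n, γ n = if A (x n) = B (y n) then α n
      else α n * min 1 (‖A (x n) - B (y n)‖ ^ 2 /
        (‖(ContinuousLinearMap.adjoint A) (A (x n) - B (y n))‖ ^ 2 +
         ‖(ContinuousLinearMap.adjoint B) (A (x n) - B (y n))‖ ^ 2)))
    -- the algorithm
    (hxhat : ∀ n, xhat n = x n - γ n • ((x n - PC (x n))
      + (ContinuousLinearMap.adjoint A) (A (x n) - B (y n))))
    (hxrec : ∀ n, x (n + 1) = δ n • u n + (1 - δ n) • xhat n)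
    (hyhat : ∀ n, yhat n = y n - γ n • ((y n - PQ (y n))
      - (ContinuousLinearMap.adjoint B) (A (x n) - B (y n))))
    (hyrec : ∀ n, y (n + 1) = δ n • v n + (1 - δ n) • yhat n)
    -- the bound G
    (G : ℝ) (hG : 0 ≤ G)
    (hGu : ∀ n, ‖u n - xs‖ ^ 2 ≤ G / 2)
    (hGv : ∀ n, ‖v n - ys‖ ^ 2 ≤ G / 2) :
    ∀ n, ‖x n - xs‖ ^ 2 + ‖y n - ys‖ ^ 2 ≤ max G (‖x 0 - xs‖ ^ 2 + ‖y 0 - ys‖ ^ 2) := by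
  have hstep (n : ℕ) : ‖xhat n - xs‖ ^ 2 + ‖yhat n - ys‖ ^ 2 ≤
      ‖x n - xs‖ ^ 2 + ‖y n - ys‖ ^ 2 := by
    obtain ⟨h0, h1, hc⟩ : 0 ≤ γ n ∧ γ n ≤ 1 ∧
        γ n * (‖(ContinuousLinearMap.adjoint A) (A (x n) - B (y n))‖ ^ 2 +
          ‖(ContinuousLinearMap.adjoint B) (A (x n) - B (y n))‖ ^ 2) ≤
          ‖A (x n) - B (y n)‖ ^ 2 := by
      rw [hγ n]
      split_ifs with h
      · exact ⟨(hα n).1.le, (hα n).2.le, by simp [h]⟩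
      · exact self_adaptive_stepsize_bounds (hα n).1.le (hα n).2.le (by positivity)
          (by positivity)
    rw [hxhat, hyhat]
    exact split_equality_step_norm_sq_le A B (hPC _ _ hxs) (hPQ _ _ hys) hAB h0 h1 hc
  intro n
  induction n with
  | zero => exact le_max_right _ _
  | succ n ih =>
    obtain ⟨h0, h1⟩ := hδ n
    have hx := norm_sq_convex_combination_sub_le (u n) (xhat n) xs h0.le h1.le
    have hy := norm_sq_convex_combination_sub_le (v n) (yhat n) ys h0.le h1.le
    rw [hxrec, hyrec]
    have hG' : ‖u n - xs‖ ^ 2 + ‖v n - ys‖ ^ 2 ≤ max G (‖x 0 - xs‖ ^ 2 + ‖y 0 - ys‖ ^ 2) :=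
      (by linarith [hGu n, hGv n] : _ ≤ G).trans (le_max_left _ _)
    have hu' := mul_le_mul_of_nonneg_left hG' h0.le
    have hx' := mul_le_mul_of_nonneg_left ((hstep n).trans ih) (sub_nonneg.2 h1.le)
    linarith
end

section
/- Let 𝔣 : H₁ → ℝ be a convex continuous function and C = {x ∈ H₁ : 𝔣(x) ≤ 0}. Let {x_n} ⊆ H₁ be a sequence, ξ_n ∈ ∂𝔣(x_n) subgradients with ‖ξ_n‖ ≤ ϑ for some constant ϑ > 0, and C_n = {x ∈ H₁ : 𝔣(x_n) + ⟨ξ_n, x − x_n⟩ ≤ 0} the corresponding half-spaces with metric projections P_{C_n}. If ‖x_n − P_{C_n} x_n‖ → 0 and x_n converges weakly to x̄, then 𝔣(x̄) ≤ 0, i.e., x̄ ∈ C. -/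
open RealInnerProductSpace Filter Topology

/-- The subdifferential of a real-valued function on a real Hilbert space. -/
def subdiff {H : Type*} [NormedAddCommGroup H] [InnerProductSpace ℝ H]
    (f : H → ℝ) (x : H) : Set H :=
  {w : H | ∀ y : H, f x + ⟪w, y - x⟫ ≤ f y}

/-- A continuous convex function which is eventually at most `c` along a weakly convergent sequence
is at most `c` at the weak limit. -/
theorem ConvexOn.le_of_tendsto_inner {H : Type*} [NormedAddCommGroup H] [InnerProductSpace ℝ H]
    [CompleteSpace H] {f : H → ℝ} (hf : ConvexOn ℝ Set.univ f) (hc : Continuous f)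
    {ι : Type*} {l : Filter ι} [l.NeBot] {x : ι → H} {a : H}
    (hx : ∀ w : H, Tendsto (fun i => ⟪w, x i⟫) l (𝓝 ⟪w, a⟫))
    {c : ℝ} (hle : ∀ᶠ i in l, f (x i) ≤ c) : f a ≤ c := by
  by_contra ha
  have hconv : Convex ℝ {z | f z ≤ c} := by simpa using hf.convex_le c
  obtain ⟨g, u, hg, hga⟩ := geometric_hahn_banach_closed_point (x := a) hconv
    (isClosed_le hc continuous_const) ha
  have hlim : Tendsto (fun i => g (x i)) l (𝓝 (g a)) := by
    simpa using hx ((InnerProductSpace.toDual ℝ H).symm g)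
  exact hga.not_ge (le_of_tendsto hlim (hle.mono fun i hi => (hg (x i) hi).le))

/-- If the subgradients ξ_n ∈ ∂𝔣(x_n) are uniformly bounded, ‖x_n − P_{C_n} x_n‖ → 0 and
x_n ⇀ x̄, then 𝔣(x̄) ≤ 0, i.e. x̄ ∈ C. -/
theorem weak_limit_in_level_set
    {H₁ : Type*}
    [NormedAddCommGroup H₁] [InnerProductSpace ℝ H₁] [CompleteSpace H₁]
    (f : H₁ → ℝ) (hfconv : ConvexOn ℝ Set.univ f) (hfcont : Continuous f)
    (x : ℕ → H₁) (ξ : ℕ → H₁)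
    (ϑ : ℝ) (hϑ : 0 < ϑ)
    (hξ : ∀ n, ξ n ∈ subdiff f (x n))
    (hξbdd : ∀ n, ‖ξ n‖ ≤ ϑ)
    -- the projections onto the half-spaces C_n = {z | f(x_n) + ⟨ξ_n, z − x_n⟩ ≤ 0}
    (PCn : ℕ → H₁ → H₁)
    (hPCn_mem : ∀ n z, f (x n) + ⟪ξ n, PCn n z - x n⟫ ≤ 0)
    (hPCn : ∀ n z w, f (x n) + ⟪ξ n, w - x n⟫ ≤ 0 → ⟪z - PCn n z, w - PCn n z⟫ ≤ 0)
    (hdist : Tendsto (fun n => ‖x n - PCn n (x n)‖) atTop (nhds 0))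
    (xbar : H₁)
    -- weak convergence x_n ⇀ x̄
    (hxw : ∀ w : H₁, Tendsto (fun n => ⟪w, x n⟫) atTop (nhds ⟪w, xbar⟫)) :
    f xbar ≤ 0 := by
  have hle : ∀ n, f (x n) ≤ ϑ * ‖x n - PCn n (x n)‖ := fun n => by
    have hmem := hPCn_mem n (x n)
    rw [← neg_sub, inner_neg_right] at hmem
    calc f (x n) ≤ ⟪ξ n, x n - PCn n (x n)⟫ := by linarith
      _ ≤ ‖ξ n‖ * ‖x n - PCn n (x n)‖ := real_inner_le_norm _ _
      _ ≤ ϑ * ‖x n - PCn n (x n)‖ := by gcongr; exact hξbdd n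
  have hlim : Tendsto (fun n => ϑ * ‖x n - PCn n (x n)‖) atTop (𝓝 0) := by
    simpa using hdist.const_mul ϑ
  refine le_of_forall_gt_imp_ge_of_dense fun ε hε => hfconv.le_of_tendsto_inner hfcont hxw ?_
  filter_upwards [hlim.eventually_le_const hε] with n hn using (hle n).trans hn
end

section
/- Let f : H₁ → H₁ be a contraction with coefficient λ ∈ [0,1), let x* ∈ H₁, δ ∈ (0,1), and x̂ ∈ H₁, and set x⁺ = δ f(x̂) + (1 − δ)x̂. Then ‖x⁺ − x*‖² ≤ (1 − δ(1 − λ²))‖x̂ − x*‖² + 2δ⟨f(x*) − x*, x⁺ − x*⟩. -/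
open RealInnerProductSpace

section InnerProductInequalities

variable {E : Type*} [NormedAddCommGroup E] [InnerProductSpace ℝ E]

theorem norm_add_sq_le_add_two_inner (w b : E) :
    ‖w + b‖ ^ 2 ≤ ‖w‖ ^ 2 + 2 * ⟪b, w + b⟫ := by
  rw [norm_add_sq_real, inner_add_right, real_inner_self_eq_norm_sq, real_inner_comm w b]
  linarith [sq_nonneg ‖b‖]

/-- Convexity of the squared norm on a real inner product space. -/
theorem norm_sq_convex_comb_le (a u : E) {t : ℝ} (ht0 : 0 ≤ t) (ht1 : t ≤ 1) :
    ‖t • a + (1 - t) • u‖ ^ 2 ≤ t * ‖a‖ ^ 2 + (1 - t) * ‖u‖ ^ 2 := by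
  have hgap : 0 ≤ t * (1 - t) * ‖a - u‖ ^ 2 :=
    mul_nonneg (mul_nonneg ht0 (sub_nonneg.2 ht1)) (sq_nonneg _)
  rw [norm_sub_sq_real] at hgap
  rw [norm_add_sq_real, norm_smul, norm_smul, mul_pow, mul_pow, Real.norm_eq_abs,
    Real.norm_eq_abs, sq_abs, sq_abs, real_inner_smul_left, real_inner_smul_right]
  linarith

end InnerProductInequalities

/-- The viscosity one-step estimate: for x⁺ = δ f(x̂) + (1 − δ)x̂,
‖x⁺ − x*‖² ≤ (1 − δ(1 − λ²))‖x̂ − x*‖² + 2δ⟨f(x*) − x*, x⁺ − x*⟩. -/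
theorem viscosity_step_estimate
    {H₁ : Type*}
    [NormedAddCommGroup H₁] [InnerProductSpace ℝ H₁] [CompleteSpace H₁]
    (f : H₁ → H₁) (lam : ℝ) (hlam0 : 0 ≤ lam) (hlam1 : lam < 1)
    (hf : ∀ x y : H₁, ‖f x - f y‖ ≤ lam * ‖x - y‖)
    (xs : H₁) (δ : ℝ) (hδ : δ ∈ Set.Ioo (0 : ℝ) 1)
    (xhat xplus : H₁)
    (hxplus : xplus = δ • f xhat + (1 - δ) • xhat) :
    ‖xplus - xs‖ ^ 2 ≤ (1 - δ * (1 - lam ^ 2)) * ‖xhat - xs‖ ^ 2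
      + 2 * δ * ⟪f xs - xs, xplus - xs⟫ := by
  have hdecomp : xplus - xs
      = (δ • (f xhat - f xs) + (1 - δ) • (xhat - xs)) + δ • (f xs - xs) := by
    rw [hxplus]; module
  have hcontr : ‖f xhat - f xs‖ ^ 2 ≤ lam ^ 2 * ‖xhat - xs‖ ^ 2 := by
    rw [← mul_pow]
    exact pow_le_pow_left₀ (norm_nonneg _) (hf xhat xs) 2
  rw [hdecomp]
  set a := f xhat - f xs
  set b := f xs - xs
  set u := xhat - xs
  have hconvex := norm_sq_convex_comb_le a u hδ.1.le hδ.2.le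
  have hsub := norm_add_sq_le_add_two_inner (δ • a + (1 - δ) • u) (δ • b)
  rw [real_inner_smul_left] at hsub
  linarith [mul_le_mul_of_nonneg_left hcontr hδ.1.le]
end

section
/- Let f : H₁ → H₁ and g : H₂ → H₂ be contractions with coefficients λ₁, λ₂ ∈ [0,1), and set λ = max{λ₁, λ₂}, assuming λ < 1/√2. Let x* ∈ H₁, y* ∈ H₂, δ ∈ (0,1), x̂ ∈ H₁, ŷ ∈ H₂, and set x⁺ = δ f(x̂) + (1 − δ)x̂ and y⁺ = δ g(ŷ) + (1 − δ)ŷ. Then ‖x⁺ − x*‖² + ‖y⁺ − y*‖² ≤ (1 − δ(1 − 2λ²))(‖x̂ − x*‖² + ‖ŷ − y*‖²) + 2δ(‖f(x*) − x*‖² + ‖g(y*) − y*‖²). -/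
open RealInnerProductSpace

/-- The viscosity estimate for a single mapping on a seminormed space. -/
theorem norm_sq_viscosity_step_sub_le {E : Type*} [SeminormedAddCommGroup E] [NormedSpace ℝ E]
    {f : E → E} {c δ : ℝ} {x z : E} (hf : ‖f x - f z‖ ≤ c * ‖x - z‖) (hδ : δ ∈ Set.Icc (0 : ℝ) 1) :
    ‖δ • f x + (1 - δ) • x - z‖ ^ 2
      ≤ (1 - δ * (1 - 2 * c ^ 2)) * ‖x - z‖ ^ 2 + 2 * δ * ‖f z - z‖ ^ 2 := by
  obtain ⟨h0, h1⟩ := hδ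
  have hconv : ‖δ • f x + (1 - δ) • x - z‖ ≤ δ * ‖f x - z‖ + (1 - δ) * ‖x - z‖ := by
    have heq : δ • f x + (1 - δ) • x - z = δ • (f x - z) + (1 - δ) • (x - z) := by module
    rw [heq]
    refine (norm_add_le _ _).trans_eq ?_
    rw [norm_smul_of_nonneg h0, norm_smul_of_nonneg (sub_nonneg.2 h1)]
  have htri : ‖f x - z‖ ≤ c * ‖x - z‖ + ‖f z - z‖ :=
    (norm_sub_le_norm_sub_add_norm_sub _ (f z) _).trans (by gcongr)
  have hsq : ‖f x - z‖ ^ 2 ≤ 2 * ((c * ‖x - z‖) ^ 2 + ‖f z - z‖ ^ 2) :=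
    (pow_le_pow_left₀ (norm_nonneg _) htri 2).trans add_sq_le
  calc ‖δ • f x + (1 - δ) • x - z‖ ^ 2
      ≤ (δ * ‖f x - z‖ + (1 - δ) * ‖x - z‖) ^ 2 := by gcongr
    _ ≤ δ * ‖f x - z‖ ^ 2 + (1 - δ) * ‖x - z‖ ^ 2 := by
        nlinarith [mul_nonneg (mul_nonneg h0 (sub_nonneg.2 h1))
          (sq_nonneg (‖f x - z‖ - ‖x - z‖))]
    _ ≤ δ * (2 * ((c * ‖x - z‖) ^ 2 + ‖f z - z‖ ^ 2)) + (1 - δ) * ‖x - z‖ ^ 2 := by gcongr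
    _ = (1 - δ * (1 - 2 * c ^ 2)) * ‖x - z‖ ^ 2 + 2 * δ * ‖f z - z‖ ^ 2 := by ring

/-- The combined viscosity estimate: for x⁺ = δ f(x̂) + (1 − δ)x̂ and
y⁺ = δ g(ŷ) + (1 − δ)ŷ with λ = max{λ₁, λ₂} < 1/√2,
‖x⁺ − x*‖² + ‖y⁺ − y*‖² ≤ (1 − δ(1 − 2λ²))(‖x̂ − x*‖² + ‖ŷ − y*‖²)
  + 2δ(‖f(x*) − x*‖² + ‖g(y*) − y*‖²). -/
theorem viscosity_pair_estimate
    {H₁ H₂ : Type*}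
    [NormedAddCommGroup H₁] [InnerProductSpace ℝ H₁] [CompleteSpace H₁]
    [NormedAddCommGroup H₂] [InnerProductSpace ℝ H₂] [CompleteSpace H₂]
    (f : H₁ → H₁) (g : H₂ → H₂) (lam₁ lam₂ lam : ℝ)
    (hlam₁0 : 0 ≤ lam₁) (hlam₁1 : lam₁ < 1)
    (hlam₂0 : 0 ≤ lam₂) (hlam₂1 : lam₂ < 1)
    (hf : ∀ x y : H₁, ‖f x - f y‖ ≤ lam₁ * ‖x - y‖)
    (hg : ∀ x y : H₂, ‖g x - g y‖ ≤ lam₂ * ‖x - y‖)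
    (hlam : lam = max lam₁ lam₂) (hlamlt : lam < 1 / Real.sqrt 2)
    (xs : H₁) (ys : H₂) (δ : ℝ) (hδ : δ ∈ Set.Ioo (0 : ℝ) 1)
    (xhat xplus : H₁) (yhat yplus : H₂)
    (hxplus : xplus = δ • f xhat + (1 - δ) • xhat)
    (hyplus : yplus = δ • g yhat + (1 - δ) • yhat) :
    ‖xplus - xs‖ ^ 2 + ‖yplus - ys‖ ^ 2
      ≤ (1 - δ * (1 - 2 * lam ^ 2)) * (‖xhat - xs‖ ^ 2 + ‖yhat - ys‖ ^ 2)
        + 2 * δ * (‖f xs - xs‖ ^ 2 + ‖g ys - ys‖ ^ 2) := by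
  have hf' : ‖f xhat - f xs‖ ≤ lam * ‖xhat - xs‖ :=
    (hf xhat xs).trans (by gcongr; exact hlam ▸ le_max_left _ _)
  have hg' : ‖g yhat - g ys‖ ≤ lam * ‖yhat - ys‖ :=
    (hg yhat ys).trans (by gcongr; exact hlam ▸ le_max_right _ _)
  rw [hxplus, hyplus]
  linarith [norm_sq_viscosity_step_sub_le hf' (Set.Ioo_subset_Icc_self hδ),
    norm_sq_viscosity_step_sub_le hg' (Set.Ioo_subset_Icc_self hδ)]
end

section
/- Assume Ω ≠ ∅ and let (x*, y*) ∈ Ω. Let f : H₁ → H₁ and g : H₂ → H₂ be contractions with coefficients λ₁, λ₂ ∈ [0, 1/√2), set λ = max{λ₁, λ₂}, let {δ_n} ⊆ (0,1), and let {γ_n} be the self-adaptive stepsizes. Let {(x_n, y_n)} be generated from arbitrary (x₀, y₀) by x̂_n = x_n − γ_n[(I − P_C)x_n + A*(Ax_n − By_n)], x_{n+1} = δ_n f(x̂_n) + (1 − δ_n)x̂_n, ŷ_n = y_n − γ_n[(I − P_Q)y_n − B*(Ax_n − By_n)], y_{n+1} = δ_n g(ŷ_n) + (1 − δ_n)ŷ_n.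 Then for all n ≥ 0, ‖x_n − x*‖² + ‖y_n − y*‖² ≤ max{‖x₀ − x*‖² + ‖y₀ − y*‖², 2(‖f(x*) − x*‖² + ‖g(y*) − y*‖²)/(1 − 2λ²)}; in particular the sequences {x_n} and {y_n} are bounded. -/
open RealInnerProductSpace Filter Topology Classical

/-- If `p` satisfies the variational inequality of a projection of `x`, then `x - p` makes an inner
product of at least `‖x - p‖ ^ 2` with `x - z`. -/
theorem norm_sub_sq_le_inner_of_variational {H : Type*} [NormedAddCommGroup H]
    [InnerProductSpace ℝ H] {x p z : H} (h : ⟪x - p, z - p⟫ ≤ 0) :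
    ‖x - p‖ ^ 2 ≤ ⟪x - z, x - p⟫ := by
  have hsplit : x - z = (x - p) - (z - p) := by abel
  rw [hsplit, inner_sub_left, real_inner_self_eq_norm_sq, real_inner_comm]
  linarith

theorem norm_add_sq_le_two_mul {H : Type*} [SeminormedAddCommGroup H] (a b : H) :
    ‖a + b‖ ^ 2 ≤ 2 * (‖a‖ ^ 2 + ‖b‖ ^ 2) :=
  (pow_le_pow_left₀ (norm_nonneg _) (norm_add_le a b) 2).trans add_sq_le

/-- Upper bound for the squared distance to `z` after a step of size `c` along `-(a + b)`. -/
theorem norm_sub_smul_add_sub_sq_le_s14 {H : Type*} [NormedAddCommGroup H] [InnerProductSpace ℝ H]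
    {c : ℝ} (hc : 0 ≤ c) {x z a b : H} (ha : ‖a‖ ^ 2 ≤ ⟪x - z, a⟫) :
    ‖x - c • (a + b) - z‖ ^ 2 ≤
      ‖x - z‖ ^ 2 - 2 * c * (‖a‖ ^ 2 + ⟪x - z, b⟫) + 2 * c ^ 2 * (‖a‖ ^ 2 + ‖b‖ ^ 2) := by
  have hsplit : x - c • (a + b) - z = (x - z) - c • (a + b) := by abel
  rw [hsplit, norm_sub_sq_real, inner_smul_right, inner_add_right, norm_smul, mul_pow,
    Real.norm_eq_abs, sq_abs]
  nlinarith [mul_le_mul_of_nonneg_left (norm_add_sq_le_two_mul a b) (sq_nonneg c),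
    mul_le_mul_of_nonneg_left ha hc]

/-- A viscosity step with a contraction `f`, compared with an arbitrary point `z`. -/
theorem norm_viscosity_step_sub_sq_le {H : Type*} [NormedAddCommGroup H] [InnerProductSpace ℝ H]
    {f : H → H} {l L d : ℝ} (hL : l ≤ L) (hf : ∀ x y, ‖f x - f y‖ ≤ l * ‖x - y‖)
    (hd0 : 0 ≤ d) (hd1 : d ≤ 1) (u z : H) :
    ‖d • f u + (1 - d) • u - z‖ ^ 2 ≤
      (1 - d * (1 - 2 * L ^ 2)) * ‖u - z‖ ^ 2 + d * (2 * ‖f z - z‖ ^ 2) := by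
  have hsplit : d • f u + (1 - d) • u - z = d • (f u - z) + (1 - d) • (u - z) := by module
  have hconv : ‖d • f u + (1 - d) • u - z‖ ^ 2 ≤
      d * ‖f u - z‖ ^ 2 + (1 - d) * ‖u - z‖ ^ 2 := by
    have hnorm : ‖d • (f u - z) + (1 - d) • (u - z)‖ ≤
        d * ‖f u - z‖ + (1 - d) * ‖u - z‖ := by
      refine (norm_add_le _ _).trans_eq ?_
      rw [norm_smul_of_nonneg hd0, norm_smul_of_nonneg (sub_nonneg.2 hd1)]
    rw [hsplit]
    refine (pow_le_pow_left₀ (norm_nonneg _) hnorm 2).trans ?_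
    nlinarith [mul_nonneg (mul_nonneg hd0 (sub_nonneg.2 hd1))
      (sq_nonneg (‖f u - z‖ - ‖u - z‖))]
  have hfu : ‖f u - z‖ ^ 2 ≤ 2 * (L ^ 2 * ‖u - z‖ ^ 2 + ‖f z - z‖ ^ 2) := by
    have hle : ‖f u - f z‖ ≤ L * ‖u - z‖ :=
      (hf u z).trans (mul_le_mul_of_nonneg_right hL (norm_nonneg _))
    have hsq := pow_le_pow_left₀ (norm_nonneg _) hle 2
    have hadd := norm_add_sq_le_two_mul (f u - f z) (f z - z)
    rw [sub_add_sub_cancel] at hadd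
    rw [mul_pow] at hsq
    linarith
  nlinarith [mul_le_mul_of_nonneg_left hfu hd0]

/-- The self-adaptive stepsize `c = a * min 1 (r / S)` satisfies `c * S ≤ r`. -/
theorem stepsize_bounds {a r S : ℝ} (ha : a ∈ Set.Ioo (0 : ℝ) 1) (hr : 0 ≤ r) (hS : 0 ≤ S) :
    0 ≤ a * min 1 (r / S) ∧ a * min 1 (r / S) ≤ 1 ∧ a * min 1 (r / S) * S ≤ r := by
  obtain ⟨ha0, ha1⟩ := ha
  have hm0 : 0 ≤ min 1 (r / S) := le_min zero_le_one (div_nonneg hr hS)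
  have hle : a * min 1 (r / S) ≤ min 1 (r / S) := mul_le_of_le_one_left hm0 ha1.le
  refine ⟨mul_nonneg ha0.le hm0, hle.trans (min_le_left _ _), ?_⟩
  refine (mul_le_mul_of_nonneg_right (hle.trans (min_le_right _ _)) hS).trans ?_
  rcases hS.eq_or_lt with rfl | hS
  · simpa using hr
  · exact (div_mul_cancel₀ r hS.ne').le

/-- A projected gradient step for the split equality problem does not increase the sum of the
squared distances to a solution, as soon as the stepsize is small enough. -/
theorem split_equality_step_le {H₁ H₂ H₃ : Type*}
    [NormedAddCommGroup H₁] [InnerProductSpace ℝ H₁] [CompleteSpace H₁]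
    [NormedAddCommGroup H₂] [InnerProductSpace ℝ H₂] [CompleteSpace H₂]
    [NormedAddCommGroup H₃] [InnerProductSpace ℝ H₃] [CompleteSpace H₃]
    (A : H₁ →L[ℝ] H₃) (B : H₂ →L[ℝ] H₃) {x p z : H₁} {y q w : H₂} (hzw : A z = B w)
    (hp : ⟪x - p, z - p⟫ ≤ 0) (hq : ⟪y - q, w - q⟫ ≤ 0) {c : ℝ} (hc0 : 0 ≤ c) (hc1 : c ≤ 1)
    (hc : c * (‖A.adjoint (A x - B y)‖ ^ 2 + ‖B.adjoint (A x - B y)‖ ^ 2) ≤ ‖A x - B y‖ ^ 2) :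
    ‖x - c • ((x - p) + A.adjoint (A x - B y)) - z‖ ^ 2 +
      ‖y - c • ((y - q) - B.adjoint (A x - B y)) - w‖ ^ 2 ≤ ‖x - z‖ ^ 2 + ‖y - w‖ ^ 2 := by
  have hx := norm_sub_smul_add_sub_sq_le_s14 hc0 (b := A.adjoint (A x - B y))
    (norm_sub_sq_le_inner_of_variational hp)
  have hy := norm_sub_smul_add_sub_sq_le_s14 hc0 (b := -B.adjoint (A x - B y))
    (norm_sub_sq_le_inner_of_variational hq)
  rw [← sub_eq_add_neg, inner_neg_right, norm_neg] at hy
  have hinner : ⟪x - z, A.adjoint (A x - B y)⟫ - ⟪y - w, B.adjoint (A x - B y)⟫ =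
      ‖A x - B y‖ ^ 2 := by
    rw [ContinuousLinearMap.adjoint_inner_right, ContinuousLinearMap.adjoint_inner_right,
      ← inner_sub_left, map_sub, map_sub, hzw, sub_sub_sub_cancel_right,
      real_inner_self_eq_norm_sq]
  have hres : 0 ≤ c * (1 - c) * (‖x - p‖ ^ 2 + ‖y - q‖ ^ 2) :=
    mul_nonneg (mul_nonneg hc0 (sub_nonneg.2 hc1)) (by positivity)
  have hgrad := mul_le_mul_of_nonneg_left hc hc0
  rw [← hinner] at hgrad
  linarith

/-- Boundedness of the viscosity-type iterates (inequality (4.3) in the paper). -/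
theorem viscosity_iterates_bounded
    {H₁ H₂ H₃ : Type*}
    [NormedAddCommGroup H₁] [InnerProductSpace ℝ H₁] [CompleteSpace H₁]
    [NormedAddCommGroup H₂] [InnerProductSpace ℝ H₂] [CompleteSpace H₂]
    [NormedAddCommGroup H₃] [InnerProductSpace ℝ H₃] [CompleteSpace H₃]
    (C : Set H₁) (Q : Set H₂)
    (hCne : C.Nonempty) (hCclosed : IsClosed C) (hCconv : Convex ℝ C)
    (hQne : Q.Nonempty) (hQclosed : IsClosed Q) (hQconv : Convex ℝ Q)
    (A : H₁ →L[ℝ] H₃) (B : H₂ →L[ℝ] H₃)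
    (PC : H₁ → H₁) (hPC_mem : ∀ x, PC x ∈ C)
    (hPC : ∀ x, ∀ z ∈ C, ⟪x - PC x, z - PC x⟫ ≤ 0)
    (PQ : H₂ → H₂) (hPQ_mem : ∀ y, PQ y ∈ Q)
    (hPQ : ∀ y, ∀ z ∈ Q, ⟪y - PQ y, z - PQ y⟫ ≤ 0)
    -- (x*, y*) ∈ Ω
    (xs : H₁) (ys : H₂) (hxs : xs ∈ C) (hys : ys ∈ Q) (hAB : A xs = B ys)
    -- the contractions
    (f : H₁ → H₁) (g : H₂ → H₂) (lam₁ lam₂ lam : ℝ)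
    (hlam₁0 : 0 ≤ lam₁) (hlam₁lt : lam₁ < 1 / Real.sqrt 2)
    (hlam₂0 : 0 ≤ lam₂) (hlam₂lt : lam₂ < 1 / Real.sqrt 2)
    (hf : ∀ x y : H₁, ‖f x - f y‖ ≤ lam₁ * ‖x - y‖)
    (hg : ∀ x y : H₂, ‖g x - g y‖ ≤ lam₂ * ‖x - y‖)
    (hlam : lam = max lam₁ lam₂)
    -- parameters
    (δ α γ : ℕ → ℝ)
    (hδ : ∀ n, δ n ∈ Set.Ioo (0 : ℝ) 1)
    (hα : ∀ n, α n ∈ Set.Ioo (0 : ℝ) 1)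
    -- iterates
    (x xhat : ℕ → H₁) (y yhat : ℕ → H₂)
    -- self-adaptive stepsize
    (hγ : ∀ n, γ n = if A (x n) = B (y n) then α n
      else α n * min 1 (‖A (x n) - B (y n)‖ ^ 2 /
        (‖(ContinuousLinearMap.adjoint A) (A (x n) - B (y n))‖ ^ 2 +
         ‖(ContinuousLinearMap.adjoint B) (A (x n) - B (y n))‖ ^ 2)))
    -- the algorithm
    (hxhat : ∀ n, xhat n = x n - γ n • ((x n - PC (x n))
      + (ContinuousLinearMap.adjoint A) (A (x n) - B (y n))))
    (hxrec : ∀ n, x (n + 1) = δ n • f (xhat n) + (1 - δ n) • xhat n)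
    (hyhat : ∀ n, yhat n = y n - γ n • ((y n - PQ (y n))
      - (ContinuousLinearMap.adjoint B) (A (x n) - B (y n))))
    (hyrec : ∀ n, y (n + 1) = δ n • g (yhat n) + (1 - δ n) • yhat n) :
    ∀ n, ‖x n - xs‖ ^ 2 + ‖y n - ys‖ ^ 2
      ≤ max (‖x 0 - xs‖ ^ 2 + ‖y 0 - ys‖ ^ 2)
          (2 * (‖f xs - xs‖ ^ 2 + ‖g ys - ys‖ ^ 2) / (1 - 2 * lam ^ 2)) := by
  set M := max (‖x 0 - xs‖ ^ 2 + ‖y 0 - ys‖ ^ 2)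
    (2 * (‖f xs - xs‖ ^ 2 + ‖g ys - ys‖ ^ 2) / (1 - 2 * lam ^ 2)) with hM
  have hlam₁ : lam₁ ≤ lam := hlam ▸ le_max_left _ _
  have hlam₂ : lam₂ ≤ lam := hlam ▸ le_max_right _ _
  have hlam0 : 0 ≤ lam := hlam₁0.trans hlam₁
  have hgap : 0 < 1 - 2 * lam ^ 2 := by
    have hlt : lam < 1 / Real.sqrt 2 := hlam ▸ max_lt hlam₁lt hlam₂lt
    have hsq := pow_lt_pow_left₀ hlt hlam0 two_ne_zero
    rw [div_pow, Real.sq_sqrt zero_le_two] at hsq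
    linarith
  have hbound : 2 * (‖f xs - xs‖ ^ 2 + ‖g ys - ys‖ ^ 2) ≤ M * (1 - 2 * lam ^ 2) :=
    (div_le_iff₀ hgap).1 (le_max_right _ _)
  intro n
  induction n with
  | zero => exact le_max_left _ _
  | succ n ih =>
    obtain ⟨hd0, hd1⟩ := hδ n
    obtain ⟨hc0, hc1, hc⟩ : 0 ≤ γ n ∧ γ n ≤ 1 ∧
        γ n * (‖A.adjoint (A (x n) - B (y n))‖ ^ 2 + ‖B.adjoint (A (x n) - B (y n))‖ ^ 2) ≤
          ‖A (x n) - B (y n)‖ ^ 2 := by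
      rw [hγ n]
      split_ifs with h
      · exact ⟨(hα n).1.le, (hα n).2.le, by simp [h]⟩
      · exact stepsize_bounds (hα n) (by positivity) (by positivity)
    have hstep := split_equality_step_le A B hAB (hPC (x n) xs hxs) (hPQ (y n) ys hys) hc0 hc1 hc
    rw [← hxhat n, ← hyhat n] at hstep
    have hx := norm_viscosity_step_sub_sq_le hlam₁ hf hd0.le hd1.le (xhat n) xs
    have hy := norm_viscosity_step_sub_sq_le hlam₂ hg hd0.le hd1.le (yhat n) ys
    rw [← hxrec n] at hx
    rw [← hyrec n] at hy
    have hcoef : 0 ≤ 1 - δ n * (1 - 2 * lam ^ 2) := by nlinarith [sq_nonneg lam]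
    have hcontr := mul_le_mul_of_nonneg_left (hstep.trans ih) hcoef
    have hdrift := mul_le_mul_of_nonneg_left hbound hd0.le
    linarith
end
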